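/- Let G be a tagged probabilistic context-free grammar with random symbols with start symbol S, E ∈ 𝓛(G), and a a parse-tree node of E. If Sever(E)(a) = (N_i, E_hole), then Expand(E)(S) = Expand(Subexpr(E)(a))(N_i) · Expand(E_hole)(S). -/

import Mathlib

/-- S-expressions over phrase tags `τ` and terminal symbols `ς`, together with the
hole symbol `□`: `(T_{ik} s)` is `leaf T_{ik} s`, `(T_{ik} E₁ … E_h)` is
`node T_{ik} [E₁,…,E_h]`, and `□` is `hole`. -/
inductive SExpr (τ ς : Type) : Type where
  | hole : SExpr τ ς
  | leaf : τ → ς → SExpr τ ς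
  | node : τ → List (SExpr τ ς) → SExpr τ ς

/-- A tagged probabilistic context-free grammar with random symbols
`G = (Σ, N, R, T, P, Q, S)`: terminals `ς`, nonterminals `ν`, and production rules indexed
by their unique phrase tags `τ`; the rule with tag `t` has left-hand side nonterminal
`lhs t` and right-hand side nonterminals `rhs t` (empty list = non-recursive rule);
`P : T → (0,1]` with the probabilities of the rules of each nonterminal summing to one;
`Q : T × Σ → [0,1]` with `∑_s Q(t,s) = 1` for each tag; start symbol `start`. -/
structure TPCFG (τ ς ν : Type) [Fintype τ] [Fintype ς] [Fintype ν]
    [DecidableEq τ] [DecidableEq ς] [DecidableEq ν] where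
  lhs : τ → ν
  rhs : τ → List ν
  P : τ → ℝ
  Q : τ → ς → ℝ
  start : ν
  P_pos : ∀ t, 0 < P t
  P_le : ∀ t, P t ≤ 1
  P_sum : ∀ n : ν, ∑ t ∈ Finset.univ.filter (fun t => lhs t = n), P t = 1
  Q_nonneg : ∀ t s, 0 ≤ Q t s
  Q_sum : ∀ t, ∑ s : ς, Q t s = 1

variable {τ ς ν : Type} [Fintype τ] [Fintype ς] [Fintype ν]
  [DecidableEq τ] [DecidableEq ς] [DecidableEq ν]

mutual
/-- The semantic function `Expand`:
`Expand((t s))(n) = P(t)·Q(t,s)` if `t` is (the tag of) a non-recursive rule of `n`;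
`Expand((t E₁…E_h))(n) = P(t)·∏_z Expand(E_z)(Ñ_z)` if `t` is a recursive rule of `n`
with right-hand side nonterminals `Ñ_1…Ñ_h`; `Expand(E)(n) = 0` when the head tag of `E`
is not a tag of a rule of `n`; and `Expand(□)(n) = 1` for the hole. -/
noncomputable def expand (G : TPCFG τ ς ν) : SExpr τ ς → ν → ℝ
  | .hole, _ => 1
  | .leaf t s, n => if G.lhs t = n ∧ G.rhs t = [] then G.P t * G.Q t s else 0
  | .node t es, n =>
      if G.lhs t = n ∧ G.rhs t ≠ [] then G.P t * expandList G es (G.rhs t) else 0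
noncomputable def expandList (G : TPCFG τ ς ν) : List (SExpr τ ς) → List ν → ℝ
  | [], [] => 1
  | e :: es, m :: ms => expand G e m * expandList G es ms
  | _, _ => 0
end

mutual
/-- `Subexpr(E)(a)`: the subexpression of `E` at parse-tree node `a` (a list of
(0-indexed) subexpression positions), if it exists. -/
def subexpr : SExpr τ ς → List ℕ → Option (SExpr τ ς)
  | e, [] => some e
  | .node _ es, j :: a => subexprList es j a
  | _, _ :: _ => none
def subexprList : List (SExpr τ ς) → ℕ → List ℕ → Option (SExpr τ ς)
  | [], _, _ => none
  | e :: _, 0, a => subexpr e a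
  | _ :: es, j + 1, a => subexprList es j a
end

mutual
/-- Replace the subexpression of `E` at parse-tree node `a` by `r`, if the node exists. -/
def replaceAt : SExpr τ ς → List ℕ → SExpr τ ς → Option (SExpr τ ς)
  | _, [], r => some r
  | .node t es, j :: a, r => (replaceAtList es j a r).map (.node t ·)
  | _, _ :: _, _ => none
def replaceAtList : List (SExpr τ ς) → ℕ → List ℕ → SExpr τ ς → Option (List (SExpr τ ς))
  | [], _, _, _ => none
  | e :: es, 0, a, r => (replaceAt e a r).map (· :: es)
  | e :: es, j + 1, a, r => (replaceAtList es j a r).map (e :: ·)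
end

/-- The head phrase tag of an s-expression. -/
def headTag : SExpr τ ς → Option τ
  | .hole => none
  | .leaf t _ => some t
  | .node t _ => some t

/-- `Sever(E)(a) = (N_i, E_hole)`: `E_hole` is `E` with the subexpression at parse-tree
node `a` replaced by the hole `□`, and `N_i` is the nonterminal from whose production rule
the head tag of the removed subexpression arises (i.e. the left-hand side of that rule);
returns `none` (failure `∅`) if `E` has no node `a`. -/
def sever (G : TPCFG τ ς ν) (E : SExpr τ ς) (a : List ℕ) : Option (ν × SExpr τ ς) :=
  match subexpr E a, replaceAt E a .hole with
  | some e, some Ehole =>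
      match headTag e with
      | some t => some (G.lhs t, Ehole)
      | none => none
  | _, _ => none

mutual
/-- `A_E`: the finite set of parse-tree nodes of an expression `E`. -/
def nodes : SExpr τ ς → Finset (List ℕ)
  | .hole => {[]}
  | .leaf _ _ => {[]}
  | .node _ es => insert [] (nodesList 0 es)
def nodesList : ℕ → List (SExpr τ ς) → Finset (List ℕ)
  | _, [] => ∅
  | j, e :: es => (nodes e).image (j :: ·) ∪ nodesList (j + 1) es
end

mutual
theorem expand_factor_aux (G : TPCFG τ ς ν) (e : SExpr τ ς) (t : τ) (ht : headTag e = some t) :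
    ∀ (E : SExpr τ ς) (a : List ℕ) (n : ν) (Eh : SExpr τ ς), expand G E n ≠ 0 →
      subexpr E a = some e → replaceAt E a .hole = some Eh →
      expand G E n = expand G e (G.lhs t) * expand G Eh n
  | E, [], n, Eh, h0, hs, hr => by
      simp only [subexpr, replaceAt, Option.some.injEq] at hs hr
      subst hs
      subst hr
      have hn : G.lhs t = n := by
        cases E with
        | hole => simp [headTag] at ht
        | leaf t' s =>
          simp only [headTag, Option.some.injEq] at ht
          subst ht
          by_contra hne
          exact h0 (by simp [expand, hne])
        | node t' es =>
          simp only [headTag, Option.some.injEq] at ht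
          subst ht
          by_contra hne
          exact h0 (by simp [expand, hne])
      rw [hn]
      simp [expand]
  | .hole, _ :: _, _, _, _, hs, _ => by simp [subexpr] at hs
  | .leaf _ _, _ :: _, _, _, _, hs, _ => by simp [subexpr] at hs
  | .node t' es, j :: a, n, Eh, h0, hs, hr => by
      simp only [subexpr] at hs
      simp only [replaceAt, Option.map_eq_some_iff] at hr
      obtain ⟨es', hr, rfl⟩ := hr
      simp only [expand] at h0 ⊢
      split_ifs at h0 ⊢ with hc
      · rw [expandList_factor_aux G e t ht es j a (G.rhs t') es' (right_ne_zero_of_mul h0) hs hr]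
        ring
      · exact absurd rfl h0
theorem expandList_factor_aux (G : TPCFG τ ς ν) (e : SExpr τ ς) (t : τ)
    (ht : headTag e = some t) :
    ∀ (es : List (SExpr τ ς)) (j : ℕ) (a : List ℕ) (ms : List ν) (es' : List (SExpr τ ς)),
      expandList G es ms ≠ 0 →
      subexprList es j a = some e → replaceAtList es j a .hole = some es' →
      expandList G es ms = expand G e (G.lhs t) * expandList G es' ms
  | [], _, _, _, _, _, hs, _ => by simp [subexprList] at hs
  | _ :: _, _, _, [], _, h0, _, _ => by simp [expandList] at h0
  | E :: es, 0, a, m :: ms, es', h0, hs, hr => by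
      simp only [subexprList] at hs
      simp only [replaceAtList, Option.map_eq_some_iff] at hr
      obtain ⟨E', hr, rfl⟩ := hr
      simp only [expandList] at h0 ⊢
      rw [expand_factor_aux G e t ht E a m E' (left_ne_zero_of_mul h0) hs hr]
      ring
  | E :: es, j + 1, a, m :: ms, es', h0, hs, hr => by
      simp only [subexprList] at hs
      simp only [replaceAtList, Option.map_eq_some_iff] at hr
      obtain ⟨es'', hr, rfl⟩ := hr
      simp only [expandList] at h0 ⊢
      rw [expandList_factor_aux G e t ht es j a ms es'' (right_ne_zero_of_mul h0) hs hr]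
      ring
end

/-- Let `G` be a tagged PCFG with random symbols and start symbol `S`,
`E ∈ 𝓛(G)` (i.e. `Expand(E)(S) > 0`), and `a ∈ A_E` a parse-tree node of `E`.
If `Sever(E)(a) = (N_i, E_hole)`, then
`Expand(E)(S) = Expand(Subexpr(E)(a))(N_i) · Expand(E_hole)(S)`. -/
theorem expand_factorization (G : TPCFG τ ς ν) (E : SExpr τ ς)
    (hE : 0 < expand G E G.start) (a : List ℕ) (ha : a ∈ nodes E)
    (Ni : ν) (Ehole : SExpr τ ς) (hsev : sever G E a = some (Ni, Ehole))
    (Esub : SExpr τ ς) (hsub : subexpr E a = some Esub) :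
    expand G E G.start = expand G Esub Ni * expand G Ehole G.start := by
  unfold sever at hsev
  rw [hsub] at hsev
  cases hr : replaceAt E a .hole with
  | none => simp [hr] at hsev
  | some Eh =>
    cases ht : headTag Esub with
    | none => simp [hr, ht] at hsev
    | some t =>
      simp only [hr, ht, Option.some.injEq, Prod.mk.injEq] at hsev
      obtain ⟨rfl, rfl⟩ := hsev
      exact expand_factor_aux G Esub t ht E a G.start Eh hE.ne' hsub hr
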